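/- Let α : ℝ≥0 → ℝ≥0 be nondecreasing and subadditive (α(s+t) ≤ α(s) + α(t)). Let F be the free group on a finite set S, let H be a group with finite generating set S′ and word length |·|_H, and equip H ≀ F with the word length |·| for the generating set S ∪ S′ (H embedded as functions supported at 1 and F as the second factor). If H admits a left-invariant measured walls structure σ with d_σ(1,h) ≥ α(|h|_H) for all h ∈ H, then H ≀ F admits a left-invariant measured walls structure whose associated pseudo-distance ρ satisfies ρ(1,γ) ≥ α(|γ|) for all γ ∈ H ≀ F. -/

import Mathlib

open MeasureTheory Function Set
open scoped ENNReal
/-- A Borel measure on the power set `2^X`, identified with `X → Bool` endowed with the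
product topology (and its Borel σ-algebra). -/
noncomputable abbrev WallMeasure (X : Type*) := @MeasureTheory.Measure (X → Bool) (borel _)

/-- The pseudo-distance associated to a wall measure:
`d_μ(x,y) = μ {A | exactly one of x, y belongs to A}`. -/
def wallDist {X : Type*} (μ : WallMeasure X) (x y : X) : ℝ≥0∞ :=
  μ {A | A x ≠ A y}

/-- A measured walls structure: all wall pseudo-distances are finite. -/
def IsMWS {X : Type*} (μ : WallMeasure X) : Prop :=
  ∀ x y : X, wallDist μ x y < ⊤

/-- Pushforward of wall measures. -/
noncomputable def wallMap {X Y : Type*} (f : (X → Bool) → (Y → Bool)) (μ : WallMeasure X) :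
    WallMeasure Y :=
  @MeasureTheory.Measure.map _ _ (borel _) (borel _) f μ

/-- Left invariance of a wall measure on a group, for the action `(k·A)(x) = A(k⁻¹x)`. -/
def IsLeftInvariantWalls {K : Type*} [Group K] (μ : WallMeasure K) : Prop :=
  ∀ k : K, wallMap (fun A x => A (k⁻¹ * x)) μ = μ

/-- `A ⊢ F` : the half-space `A` cuts the subset `F`, i.e. `F` is neither contained in `A`
nor in its complement. -/
def CutsB {X : Type*} (A : X → Bool) (F : Set X) : Prop :=
  (∃ x ∈ F, A x = true) ∧ (∃ x ∈ F, A x = false)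
/-- Word length with respect to a generating set `T` (elements of `T` and their inverses). -/
noncomputable def wordLength {K : Type*} [Group K] (T : Set K) (k : K) : ℕ :=
  sInf {n | ∃ l : List K, l.length = n ∧ (∀ x ∈ l, x ∈ T ∨ x⁻¹ ∈ T) ∧ l.prod = k}
/-- The group of finitely supported functions `X → H` under pointwise multiplication. -/
def FinSuppSubgroup (H : Type*) [Group H] (X : Type*) : Subgroup (X → H) where
  carrier := {w | (Function.mulSupport w).Finite}
  one_mem' := by simpa [Function.mulSupport_one] using Set.finite_empty
  mul_mem' := by
    intro a b ha hb
    exact (ha.union hb).subset (Function.mulSupport_mul a b)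
  inv_mem' := by
    intro a ha
    simpa [Function.mulSupport_inv] using ha

/-- The shift action of `G` on finitely supported functions `X → H`, for a `G`-set `X`:
`(g·w)(x) = w(g⁻¹ • x)`. -/
def wreathShift (H : Type*) [Group H] (X : Type*) (G : Type*) [Group G] [MulAction G X] :
    G →* MulAut (FinSuppSubgroup H X) where
  toFun g :=
    { toFun := fun w => ⟨fun x => (w : X → H) (g⁻¹ • x), by
        refine (w.2.image (fun x => g • x)).subset ?_
        intro x hx
        exact ⟨g⁻¹ • x, hx, by simp⟩⟩
      invFun := fun w => ⟨fun x => (w : X → H) (g • x), by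
        refine (w.2.image (fun x => g⁻¹ • x)).subset ?_
        intro x hx
        exact ⟨g • x, hx, by simp⟩⟩
      left_inv := by intro w; apply Subtype.ext; funext x; simp
      right_inv := by intro w; apply Subtype.ext; funext x; simp
      map_mul' := by intro a b; rfl }
  map_one' := by
    apply MulEquiv.ext; intro w; apply Subtype.ext; funext x; simp
  map_mul' := by
    intro a b
    apply MulEquiv.ext; intro w; apply Subtype.ext; funext x
    simp [mul_smul]

/-- The permutational wreath product `H ≀_X G = H^{(X)} ⋊ G`. -/
abbrev PermWreath (H : Type*) [Group H] (X : Type*) (G : Type*) [Group G] [MulAction G X] :=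
  FinSuppSubgroup H X ⋊[wreathShift H X G] G

/-- The standard wreath product `H ≀ G = H^{(G)} ⋊ G`. -/
abbrev StandardWreath (H : Type*) [Group H] (G : Type*) [Group G] := PermWreath H G G

open scoped Classical in
/-- The copy of `h : H` in `H^{(F)}` supported at the identity of `F`. -/
noncomputable def atOne {H F : Type*} [Group H] [Group F] (h : H) : FinSuppSubgroup H F :=
  ⟨fun x => if x = 1 then h else 1, by
    refine (Set.finite_singleton (1 : F)).subset ?_
    intro x hx
    by_contra hne
    exact hx (if_neg hne)⟩

/-- The canonical generating set `S ∪ S'` of the wreath product `H ≀ F(S)`, where `H` is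
embedded as functions supported at `1` and the free group `F(S)` as the second factor. -/
noncomputable def wreathGen {H : Type*} [Group H] (S' : Set H) (S : Type*) :
    Set (StandardWreath H (FreeGroup S)) :=
  {γ | ∃ h ∈ S', γ = SemidirectProduct.inl (atOne h)} ∪
  {γ | ∃ s : S, γ = SemidirectProduct.inr (FreeGroup.of s)}

namespace WreathWalls

section Measures

/-- The Borel σ-algebra on the power set of `X`. -/
@[reducible] def borelWalls (X : Type*) : MeasurableSpace (X → Bool) := borel _

attribute [local instance] borelWalls

theorem borelSpace_walls (X : Type*) : BorelSpace (X → Bool) := ⟨rfl⟩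

attribute [local instance] borelSpace_walls

variable {X Y Z : Type*}

theorem measurable_precomp (φ : X → Y) : Measurable (fun (A : Y → Bool) x => A (φ x)) :=
  (continuous_pi fun x => continuous_apply (φ x)).measurable

theorem measurableSet_separates (x y : X) : MeasurableSet {A : X → Bool | A x ≠ A y} := by
  have h : IsOpen {A : X → Bool | A x ≠ A y} :=
    IsOpen.preimage (f := fun A : X → Bool => (A x, A y)) (by fun_prop)
      (isOpen_discrete {p : Bool × Bool | p.1 ≠ p.2})
  exact h.measurableSet

theorem wallDist_self (μ : WallMeasure X) (x : X) : wallDist μ x x = 0 := by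
  simp [wallDist]

theorem wallDist_wallMap_precomp (φ : X → Y) (μ : WallMeasure Y) (x y : X) :
    wallDist (wallMap (fun A x => A (φ x)) μ) x y = wallDist μ (φ x) (φ y) :=
  Measure.map_apply (measurable_precomp φ) (measurableSet_separates x y)

theorem wallMap_precomp_comp (φ : X → Y) (ψ : Y → Z) (μ : WallMeasure Z) :
    wallMap (fun A x => A (φ x)) (wallMap (fun A y => A (ψ y)) μ) =
      wallMap (fun A x => A (ψ (φ x))) μ :=
  Measure.map_map (measurable_precomp φ) (measurable_precomp ψ)

/-- The sum of a family of wall measures. -/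
noncomputable def wallSum {ι : Type*} (μ : ι → WallMeasure X) : WallMeasure X := Measure.sum μ

/-- The Dirac wall measure at `A`. -/
noncomputable def wallDirac (A : X → Bool) : WallMeasure X := Measure.dirac A

theorem wallDist_wallSum {ι : Type*} (μ : ι → WallMeasure X) (x y : X) :
    wallDist (wallSum μ) x y = ∑' i, wallDist (μ i) x y :=
  Measure.sum_apply _ (measurableSet_separates x y)

open scoped Classical in
theorem wallDist_wallDirac (A : X → Bool) (x y : X) :
    wallDist (wallDirac A) x y = if A x ≠ A y then 1 else 0 := by
  rw [wallDist, wallDirac, Measure.dirac_apply' _ (measurableSet_separates x y)]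
  simp [Set.indicator_apply]

theorem wallMap_wallDirac (φ : X → Y) (A : Y → Bool) :
    wallMap (fun A x => A (φ x)) (wallDirac A) = wallDirac (fun x => A (φ x)) :=
  Measure.map_dirac' (measurable_precomp φ) A

theorem wallMap_wallSum {ι : Type*} (φ : X → Y) (μ : ι → WallMeasure Y) :
    wallMap (fun A x => A (φ x)) (wallSum μ) =
      wallSum fun i => wallMap (fun A x => A (φ x)) (μ i) :=
  Measure.map_sum (measurable_precomp φ).aemeasurable

theorem isLeftInvariantWalls_wallSum {K ι : Type*} [Group K] (μ : ι → WallMeasure K)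
    (e : K → ι ≃ ι) (h : ∀ k i, wallMap (fun A x => A (k⁻¹ * x)) (μ i) = μ (e k i)) :
    IsLeftInvariantWalls (wallSum μ) := by
  intro k
  rw [wallMap_wallSum]
  simp only [h]
  exact Measure.sum_comp_equiv (e k) μ

theorem wallDist_add (μ ν : WallMeasure X) (x y : X) :
    wallDist (μ + ν) x y = wallDist μ x y + wallDist ν x y :=
  Measure.add_apply μ ν _

theorem wallDist_smul (c : ℝ≥0∞) (μ : WallMeasure X) (x y : X) :
    wallDist (c • μ) x y = c * wallDist μ x y :=
  Measure.smul_apply c μ _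

theorem isLeftInvariantWalls_add {K : Type*} [Group K] {μ ν : WallMeasure K}
    (hμ : IsLeftInvariantWalls μ) (hν : IsLeftInvariantWalls ν) :
    IsLeftInvariantWalls (μ + ν) := fun k => by
  have h := Measure.map_add μ ν (measurable_precomp (fun x : K => k⁻¹ * x))
  exact h.trans (congrArg₂ (· + ·) (hμ k) (hν k))

theorem isLeftInvariantWalls_smul {K : Type*} [Group K] {μ : WallMeasure K}
    (hμ : IsLeftInvariantWalls μ) (c : ℝ≥0∞) : IsLeftInvariantWalls (c • μ) := fun k => by
  have h := Measure.map_smul (mβ := borelWalls K) c μ (fun (A : K → Bool) x => A (k⁻¹ * x))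
  exact h.trans (congrArg (c • ·) (hμ k))

/-- The counting measure on a set of half-spaces. -/
noncomputable def wallCount (W : Set (X → Bool)) : WallMeasure X :=
  wallSum fun E : W => wallDirac E.1

theorem wallDist_wallCount (W : Set (X → Bool)) (x y : X) :
    wallDist (wallCount W) x y = ({E ∈ W | E x ≠ E y}.encard : ℝ≥0∞) := by
  classical
  simp only [wallCount, wallDist_wallSum, wallDist_wallDirac]
  rw [tsum_subtype W fun E => if E x ≠ E y then (1 : ℝ≥0∞) else 0]
  rw [← ENNReal.tsum_set_one, tsum_subtype _ fun _ => (1 : ℝ≥0∞)]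
  congr 1
  ext E
  by_cases h₁ : E ∈ W <;> by_cases h₂ : E x ≠ E y <;> simp [Set.indicator, h₁, h₂]

theorem isLeftInvariantWalls_wallCount {K : Type*} [Group K] (W : Set (K → Bool))
    (hW : ∀ (k : K), ∀ E ∈ W, (fun x => E (k * x)) ∈ W) :
    IsLeftInvariantWalls (wallCount W) := by
  refine isLeftInvariantWalls_wallSum _
    (fun k => ⟨fun E => ⟨_, hW k⁻¹ E E.2⟩, fun E => ⟨_, hW k E E.2⟩, ?_, ?_⟩) ?_
  · intro E
    simp
  · intro E
    simp
  · intro k E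
    exact wallMap_wallDirac _ _

end Measures

section HalfTrees

theorem not_isReduced_cancel {S : Type*} (s : S) (b : Bool) (r : List (S × Bool)) :
    ¬ FreeGroup.IsReduced ((s, b) :: (s, !b) :: r) := by
  rw [FreeGroup.isReduced_cons_cons]
  simp

variable {S : Type*} [DecidableEq S]

/-- The vertices of the Cayley tree of `FreeGroup S` whose geodesic from `1` begins with `L`. -/
def shadow (L : List (S × Bool)) : Set (FreeGroup S) := {x | L <+: x.toWord}

/-- The half-trees of the Cayley tree of `FreeGroup S`. -/
def halfTrees (S : Type*) [DecidableEq S] : Set (Set (FreeGroup S)) :=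
  {A | ∃ L : List (S × Bool), L ≠ [] ∧ FreeGroup.IsReduced L ∧ (A = shadow L ∨ A = (shadow L)ᶜ)}

theorem toWord_letter_mul (t : S × Bool) (x : FreeGroup S) :
    (x.toWord = (t.1, !t.2) :: (FreeGroup.mk [t] * x).toWord) ∨
      (∀ r, x.toWord ≠ (t.1, !t.2) :: r) ∧
        (FreeGroup.mk [t] * x).toWord = t :: x.toWord := by
  have h : (FreeGroup.mk [t] * x).toWord = FreeGroup.reduce (t :: x.toWord) := by
    rw [FreeGroup.toWord_mul, FreeGroup.toWord_mk, FreeGroup.reduce_singleton,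
      List.singleton_append]
  rw [h, FreeGroup.reduce.cons, FreeGroup.reduce_toWord]
  obtain ⟨s, b⟩ := t
  cases x.toWord with
  | nil => right; simp
  | cons c r =>
    obtain ⟨s', b'⟩ := c
    by_cases hc : s = s' ∧ b = !b'
    · left
      obtain ⟨rfl, rfl⟩ := hc
      simp
    · right
      refine ⟨fun r' hr => hc ?_, by simp [hc]⟩
      simp only [List.cons.injEq, Prod.mk.injEq] at hr
      obtain ⟨⟨rfl, rfl⟩, -⟩ := hr
      simp

theorem preimage_letter_shadow_mem_halfTrees (t : S × Bool) {L : List (S × Bool)} (hL : L ≠ [])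
    (hr : FreeGroup.IsReduced L) : {y | FreeGroup.mk [t] * y ∈ shadow L} ∈ halfTrees S := by
  obtain ⟨s, b⟩ := t
  obtain ⟨a, L, rfl⟩ := List.exists_cons_of_ne_nil hL
  by_cases ha : a = (s, b)
  · subst ha
    rcases eq_or_ne L [] with rfl | hL'
    · refine ⟨[(s, !b)], by simp, FreeGroup.IsReduced.singleton, Or.inr ?_⟩
      ext y
      simp only [shadow, mem_ofPred_eq, mem_compl_iff]
      rcases toWord_letter_mul (s, b) y with h | ⟨h₁, h₂⟩
      · have hy : FreeGroup.IsReduced y.toWord := FreeGroup.isReduced_toWord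
        rw [h] at hy ⊢
        refine iff_of_false ?_ (by simp)
        rintro ⟨r, hr'⟩
        rw [← hr'] at hy
        have := not_isReduced_cancel s (!b) r
        simp only [Bool.not_not] at this
        exact this hy
      · rw [h₂]
        refine iff_of_true (by simp) ?_
        rintro ⟨r, hr'⟩
        exact h₁ r hr'.symm
    · refine ⟨L, hL', hr.infix (List.suffix_cons _ _).isInfix, Or.inl ?_⟩
      ext y
      simp only [shadow, mem_ofPred_eq]
      rcases toWord_letter_mul (s, b) y with h | ⟨h₁, h₂⟩
      · have hy : FreeGroup.IsReduced y.toWord := FreeGroup.isReduced_toWord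
        refine iff_of_false ?_ ?_
        · rintro ⟨r, hr'⟩
          rw [h, ← hr'] at hy
          have := not_isReduced_cancel s (!b) (L ++ r)
          simp only [Bool.not_not] at this
          exact this hy
        · rintro ⟨r, hr'⟩
          obtain ⟨a, L, rfl⟩ := List.exists_cons_of_ne_nil hL'
          rw [h, List.cons_append, List.cons.injEq] at hr'
          rw [hr'.1] at hr
          exact not_isReduced_cancel _ _ _ hr
      · rw [h₂, List.cons_prefix_cons]
        simp
  · refine ⟨(s, !b) :: a :: L, by simp, ?_, Or.inl ?_⟩
    · rw [FreeGroup.isReduced_cons_cons]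
      refine ⟨fun h => ?_, hr⟩
      by_contra hb
      apply ha
      obtain ⟨s', b'⟩ := a
      simp only at h hb
      subst h
      cases b <;> cases b' <;> simp_all
    · ext y
      simp only [shadow, mem_ofPred_eq]
      rcases toWord_letter_mul (s, b) y with h | ⟨h₁, h₂⟩
      · conv_rhs => rw [h]
        rw [List.cons_prefix_cons]
        simp
      · rw [h₂, List.cons_prefix_cons]
        refine iff_of_false (fun h => ha h.1) ?_
        rintro ⟨r, hr'⟩
        exact h₁ _ hr'.symm

theorem preimage_letter_mem_halfTrees (t : S × Bool) {A : Set (FreeGroup S)}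
    (hA : A ∈ halfTrees S) : {y | FreeGroup.mk [t] * y ∈ A} ∈ halfTrees S := by
  obtain ⟨L, hL, hr, rfl | rfl⟩ := hA
  · exact preimage_letter_shadow_mem_halfTrees t hL hr
  · obtain ⟨L', hL', hr', h⟩ := preimage_letter_shadow_mem_halfTrees t hL hr
    refine ⟨L', hL', hr', ?_⟩
    have hc : {y | FreeGroup.mk [t] * y ∈ (shadow L)ᶜ} =
      {y | FreeGroup.mk [t] * y ∈ shadow L}ᶜ := rfl
    rw [hc]
    rcases h with h | h
    · exact Or.inr (by rw [h])
    · exact Or.inl (by rw [h, compl_compl])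

theorem preimage_mul_mem_halfTrees (g : FreeGroup S) {A : Set (FreeGroup S)}
    (hA : A ∈ halfTrees S) : {y | g * y ∈ A} ∈ halfTrees S := by
  induction g generalizing A with
  | C1 => simpa using hA
  | of s => exact preimage_letter_mem_halfTrees (s, true) hA
  | inv_of s _ => exact preimage_letter_mem_halfTrees (s, false) hA
  | mul g h hg hh =>
    have := hh (hg hA)
    simpa [mul_assoc] using this

/-- The edges of the subtree spanned by `1` and `K`, each labelled by the word of its endpoint
farther from `1`. -/
def hullEdges (K : Finset (FreeGroup S)) : Finset (List (S × Bool)) :=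
  (K.biUnion fun x => x.toWord.inits.toFinset).erase []

theorem mem_hullEdges {K : Finset (FreeGroup S)} {L : List (S × Bool)} :
    L ∈ hullEdges K ↔ L ≠ [] ∧ ∃ x ∈ K, L <+: x.toWord := by
  simp [hullEdges]

theorem isReduced_of_mem_hullEdges {K : Finset (FreeGroup S)} {L : List (S × Bool)}
    (h : L ∈ hullEdges K) : FreeGroup.IsReduced L := by
  obtain ⟨-, x, -, hx⟩ := mem_hullEdges.1 h
  exact FreeGroup.isReduced_toWord.infix hx.isInfix

theorem norm_le_card_hullEdges {K : Finset (FreeGroup S)} {x : FreeGroup S} (hx : x ∈ K) :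
    x.norm ≤ (hullEdges K).card := by
  rw [← Finset.card_range x.norm]
  refine Finset.card_le_card_of_injOn (fun i => x.toWord.take (i + 1)) ?_ ?_
  · intro i hi
    simp only [Finset.coe_range, mem_Iio, FreeGroup.norm] at hi
    refine mem_hullEdges.2 ⟨fun h => ?_, x, hx, List.take_prefix _ _⟩
    have := congrArg List.length h
    simp at this
    simp [this] at hi
  · intro i hi j hj h
    simp only [Finset.coe_range, mem_Iio, FreeGroup.norm] at hi hj
    have := congrArg List.length h
    simp only [List.length_take] at this
    omega

theorem shadow_injective {L L' : List (S × Bool)} (hL : FreeGroup.IsReduced L)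
    (hL' : FreeGroup.IsReduced L') (h : shadow L = shadow L') : L = L' := by
  have key : ∀ M : List (S × Bool), FreeGroup.IsReduced M → (FreeGroup.mk M).toWord = M :=
    fun M hM => by rw [FreeGroup.toWord_mk, hM.reduce_eq]
  have h₁ : FreeGroup.mk L ∈ shadow L' := by
    rw [← h, shadow, mem_ofPred_eq, key L hL]
  have h₂ : FreeGroup.mk L' ∈ shadow L := by
    rw [h, shadow, mem_ofPred_eq, key L' hL']
  rw [shadow, mem_ofPred_eq, key L hL] at h₁
  rw [shadow, mem_ofPred_eq, key L' hL'] at h₂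
  exact h₂.eq_of_length (le_antisymm h₂.length_le h₁.length_le)

theorem one_notMem_shadow {L : List (S × Bool)} (hL : L ≠ []) : (1 : FreeGroup S) ∉ shadow L := by
  simpa [shadow] using hL

theorem finite_halfTrees_cutting (K : Finset (FreeGroup S)) :
    {A ∈ halfTrees S | (∃ x ∈ K, x ∈ A) ∧ ∃ x ∈ K, x ∉ A}.Finite := by
  refine ((hullEdges K).finite_toSet.image shadow |>.union
    ((hullEdges K).finite_toSet.image fun L => (shadow L)ᶜ)).subset ?_
  rintro A ⟨⟨L, hL, -, rfl | rfl⟩, ⟨x, hx, hxA⟩, y, hy, hyA⟩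
  · exact Or.inl ⟨L, mem_hullEdges.2 ⟨hL, x, hx, hxA⟩, rfl⟩
  · exact Or.inr ⟨L, mem_hullEdges.2 ⟨hL, y, hy, not_not.1 hyA⟩, rfl⟩

end HalfTrees

section Walls

variable {H S : Type*} [Group H]

theorem right_mul_apply (k y : StandardWreath H (FreeGroup S)) :
    (k * y).right = k.right * y.right := rfl

theorem left_mul_apply (k y : StandardWreath H (FreeGroup S)) (x : FreeGroup S) :
    ((k * y).left : FreeGroup S → H) x =
      (k.left : FreeGroup S → H) x * (y.left : FreeGroup S → H) (k.right⁻¹ * x) := rfl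

/-- The walls of `H` pulled back along all the lamps. -/
noncomputable def lampWalls (S : Type*) (σ : WallMeasure H) :
    WallMeasure (StandardWreath H (FreeGroup S)) :=
  wallSum fun x : FreeGroup S => wallMap (fun A y => A ((y.left : FreeGroup S → H) x)) σ

theorem wallDist_lampWalls (σ : WallMeasure H) (y z : StandardWreath H (FreeGroup S)) :
    wallDist (lampWalls S σ) y z =
      ∑' x, wallDist σ ((y.left : FreeGroup S → H) x) ((z.left : FreeGroup S → H) x) := by
  simp only [lampWalls, wallDist_wallSum]
  exact tsum_congr fun x => wallDist_wallMap_precomp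
    (fun y : StandardWreath H (FreeGroup S) => (y.left : FreeGroup S → H) x) σ y z

theorem isMWS_lampWalls {σ : WallMeasure H} (hσ : IsMWS σ) : IsMWS (lampWalls S σ) := by
  intro y z
  rw [wallDist_lampWalls, tsum_eq_sum (s := (y.left.2.union z.left.2).toFinset)]
  · exact ENNReal.sum_lt_top.2 fun x _ => hσ _ _
  · intro x hx
    simp only [Finite.mem_toFinset, mem_union, mem_mulSupport, not_or, not_not] at hx
    rw [hx.1, hx.2, wallDist_self]

theorem isLeftInvariantWalls_lampWalls {σ : WallMeasure H} (hσ : IsLeftInvariantWalls σ) :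
    IsLeftInvariantWalls (lampWalls S σ) := by
  refine isLeftInvariantWalls_wallSum _ (fun k => Equiv.mulLeft k.right) fun k x => ?_
  simp only [Equiv.coe_mulLeft]
  conv_rhs => rw [← hσ ((k.left : FreeGroup S → H) (k.right * x))]
  rw [wallMap_precomp_comp (fun y => k⁻¹ * y)
      (fun y : StandardWreath H (FreeGroup S) => (y.left : FreeGroup S → H) x) σ,
    wallMap_precomp_comp (fun y : StandardWreath H (FreeGroup S) =>
      (y.left : FreeGroup S → H) (k.right * x))
      (fun h => ((k.left : FreeGroup S → H) (k.right * x))⁻¹ * h) σ]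
  congr 1
  funext A y
  congr 1
  rw [left_mul_apply, SemidirectProduct.inv_right, inv_inv, SemidirectProduct.inv_left]
  congr 1
  change ((k.left : FreeGroup S → H) (k.right⁻¹⁻¹ * x))⁻¹ = _
  rw [inv_inv]

theorem sum_le_wallDist_lampWalls (σ : WallMeasure H) (y z : StandardWreath H (FreeGroup S))
    (Q : Finset (FreeGroup S)) :
    ∑ x ∈ Q, wallDist σ ((y.left : FreeGroup S → H) x) ((z.left : FreeGroup S → H) x) ≤
      wallDist (lampWalls S σ) y z := by
  rw [wallDist_lampWalls]
  exact ENNReal.sum_le_tsum _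

open scoped Classical in
/-- The half-space of all elements with cursor in `A` and with lamps outside `A` given by `u`. -/
noncomputable def treeWall (A : Set (FreeGroup S)) (u : FreeGroup S → H) :
    StandardWreath H (FreeGroup S) → Bool :=
  fun y => decide (y.right ∈ A ∧ ∀ x ∉ A, (y.left : FreeGroup S → H) x = u x)

theorem treeWall_eq_true {A : Set (FreeGroup S)} {u : FreeGroup S → H}
    {y : StandardWreath H (FreeGroup S)} :
    treeWall A u y = true ↔ y.right ∈ A ∧ ∀ x ∉ A, (y.left : FreeGroup S → H) x = u x := by
  simp [treeWall]

theorem treeWall_congr {A : Set (FreeGroup S)} {u v : FreeGroup S → H}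
    (h : ∀ x ∉ A, u x = v x) : treeWall A u = treeWall A v := by
  funext y
  rw [Bool.eq_iff_iff, treeWall_eq_true, treeWall_eq_true]
  exact and_congr_right fun _ => forall₂_congr fun x hx => by rw [h x hx]

theorem treeWall_left_injective (w : FinSuppSubgroup H (FreeGroup S)) :
    Function.Injective fun A : Set (FreeGroup S) => treeWall A (w : FreeGroup S → H) := by
  have key : ∀ (A : Set (FreeGroup S)) x, x ∈ A ↔ treeWall A (w : FreeGroup S → H) ⟨w, x⟩ = true :=
    fun A x => by simp [treeWall_eq_true]
  intro A B h
  ext x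
  rw [key A, key B]
  exact iff_of_eq (congrArg (· = true) (congrFun h _))

theorem treeWall_comp_mul (k : StandardWreath H (FreeGroup S)) (A : Set (FreeGroup S))
    (u : FreeGroup S → H) :
    (fun y => treeWall A u (k * y)) = treeWall {z | k.right * z ∈ A}
      fun z => ((k.left : FreeGroup S → H) (k.right * z))⁻¹ * u (k.right * z) := by
  funext y
  rw [Bool.eq_iff_iff, treeWall_eq_true, treeWall_eq_true, right_mul_apply]
  refine and_congr_right fun _ => ⟨fun h z hz => ?_, fun h x hx => ?_⟩
  · rw [← h _ hz, left_mul_apply]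
    simp
  · have := h (k.right⁻¹ * x) (by simpa using hx)
    rw [mul_inv_cancel_left] at this
    rw [left_mul_apply, this, mul_inv_cancel_left]

variable [DecidableEq S]

/-- The walls of the wreath product defined by the half-trees of the Cayley tree. -/
def treeWallSet (H S : Type*) [Group H] [DecidableEq S] :
    Set (StandardWreath H (FreeGroup S) → Bool) :=
  {E | ∃ A ∈ halfTrees S, ∃ u : FreeGroup S → H, E = treeWall A u}

theorem isLeftInvariantWalls_treeWalls :
    IsLeftInvariantWalls (wallCount (treeWallSet H S)) := by
  refine isLeftInvariantWalls_wallCount _ ?_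
  rintro k _ ⟨A, hA, u, rfl⟩
  exact ⟨_, preimage_mul_mem_halfTrees k.right hA, _, treeWall_comp_mul k A u⟩

theorem finite_treeWalls_mem_notMem (y z : StandardWreath H (FreeGroup S)) :
    {E ∈ treeWallSet H S | E y = true ∧ E z = false}.Finite := by
  let K : Finset (FreeGroup S) :=
    insert y.right (insert z.right (y.left.2.union z.left.2).toFinset)
  refine ((finite_halfTrees_cutting K).image
    fun A => treeWall A (y.left : FreeGroup S → H)).subset ?_
  rintro _ ⟨⟨A, hA, u, rfl⟩, hy, hz⟩
  obtain ⟨hyA, hyu⟩ := treeWall_eq_true.1 hy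
  refine ⟨A, ⟨hA, ⟨y.right, by simp [K], hyA⟩, ?_⟩, treeWall_congr hyu⟩
  by_contra! h
  have hzu : treeWall A u z = true := by
    refine treeWall_eq_true.2 ⟨h _ (by simp [K]), fun x hx => ?_⟩
    rw [← hyu x hx]
    have hxK : x ∉ K := fun hxK => hx (h x hxK)
    simp only [K, Finset.mem_insert, Finite.mem_toFinset, mem_union, mem_mulSupport,
      not_or, not_not] at hxK
    rw [hxK.2.2.1, hxK.2.2.2]
  simp [hzu] at hz

theorem isMWS_treeWalls : IsMWS (wallCount (treeWallSet H S)) := by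
  intro y z
  have hfin : {E ∈ treeWallSet H S | E y ≠ E z}.Finite := by
    refine ((finite_treeWalls_mem_notMem y z).union (finite_treeWalls_mem_notMem z y)).subset ?_
    rintro E ⟨hE, hne⟩
    cases h₁ : E y <;> cases h₂ : E z <;> simp_all
  rw [wallDist_wallCount, hfin.encard_eq_coe_toFinset_card]
  simp

theorem card_hullEdges_le_wallDist (γ : StandardWreath H (FreeGroup S)) :
    ((hullEdges (insert γ.right (Set.Finite.toFinset γ.left.2))).card : ℝ≥0∞) ≤
      wallDist (wallCount (treeWallSet H S)) 1 γ := by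
  classical
  set K := insert γ.right (Set.Finite.toFinset γ.left.2)
  rw [wallDist_wallCount]
  let side : List (S × Bool) → Set (FreeGroup S) := fun L =>
    if γ.right ∈ shadow L then shadow L else (shadow L)ᶜ
  have hside : ∀ L, γ.right ∈ side L := by
    intro L
    by_cases h : γ.right ∈ shadow L <;> simp [side, h]
  let E : List (S × Bool) → StandardWreath H (FreeGroup S) → Bool := fun L =>
    treeWall (side L) (γ.left : FreeGroup S → H)
  have hEγ : ∀ L, E L γ = true := fun L => treeWall_eq_true.2 ⟨hside L, fun _ _ => rfl⟩
  have hE1 : ∀ L ∈ hullEdges K, E L 1 ≠ true := by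
    intro L hL h
    obtain ⟨hL0, x, hxK, hx⟩ := mem_hullEdges.1 hL
    obtain ⟨h1, h2⟩ := treeWall_eq_true.1 h
    by_cases hs : γ.right ∈ shadow L
    · simp only [side, hs, if_true] at h1
      exact one_notMem_shadow hL0 h1
    · simp only [side, hs, if_false] at h2
      have := h2 x (not_not_intro hx)
      rcases Finset.mem_insert.1 hxK with rfl | hxQ
      · exact hs hx
      · exact (Set.Finite.mem_toFinset _).1 hxQ this.symm
  have hinj : Set.InjOn E (hullEdges K) := by
    intro L hL L' hL' h
    have h1 : side L = side L' := treeWall_left_injective γ.left h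
    have hs1 := one_notMem_shadow (mem_hullEdges.1 hL).1
    have hs2 := one_notMem_shadow (mem_hullEdges.1 hL').1
    refine shadow_injective (isReduced_of_mem_hullEdges hL) (isReduced_of_mem_hullEdges hL') ?_
    have h2 : (1 : FreeGroup S) ∈ side L ↔ (1 : FreeGroup S) ∈ side L' := by rw [h1]
    by_cases ha : γ.right ∈ shadow L <;> by_cases hb : γ.right ∈ shadow L' <;>
      simp only [side, ha, hb, if_true, if_false, mem_compl_iff, hs1, hs2, not_false_eq_true,
        iff_true, iff_false, not_true_eq_false, compl_inj_iff] at h1 h2 <;> assumption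
  have hsub : E '' (hullEdges K) ⊆ {E ∈ treeWallSet H S | E 1 ≠ E γ} := by
    rintro _ ⟨L, hL, rfl⟩
    refine ⟨⟨side L, ⟨L, (mem_hullEdges.1 hL).1, isReduced_of_mem_hullEdges hL, ?_⟩, _, rfl⟩, ?_⟩
    · by_cases h : γ.right ∈ shadow L <;> simp [side, h]
    · rw [hEγ]
      exact hE1 L hL
  have hcard := Set.encard_le_encard hsub
  rw [hinj.encard_image, Set.encard_coe_eq_coe_finsetCard] at hcard
  exact_mod_cast hcard

end Walls

section Words

/-- `k` is a product of at most `n` elements of `T` and their inverses. -/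
def HasWord {K : Type*} [Group K] (T : Set K) (k : K) (n : ℕ) : Prop :=
  ∃ l : List K, l.length ≤ n ∧ (∀ x ∈ l, x ∈ T ∨ x⁻¹ ∈ T) ∧ l.prod = k

variable {K K' : Type*} [Group K] [Group K'] {T : Set K} {T' : Set K'}

theorem HasWord.mono {k : K} {m n : ℕ} (h : HasWord T k m) (hmn : m ≤ n) : HasWord T k n :=
  let ⟨l, hl, h'⟩ := h
  ⟨l, hl.trans hmn, h'⟩

theorem HasWord.mul {k k' : K} {m n : ℕ} (h : HasWord T k m) (h' : HasWord T k' n) :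
    HasWord T (k * k') (m + n) := by
  obtain ⟨l, hl, hT, rfl⟩ := h
  obtain ⟨l', hl', hT', rfl⟩ := h'
  refine ⟨l ++ l', by simpa using add_le_add hl hl', fun x hx => ?_, List.prod_append⟩
  exact (List.mem_append.1 hx).elim (hT x) (hT' x)

theorem HasWord.map {k : K} {n : ℕ} (h : HasWord T k n) (φ : K →* K')
    (hφ : ∀ x ∈ T, φ x ∈ T') : HasWord T' (φ k) n := by
  obtain ⟨l, hl, hT, rfl⟩ := h
  refine ⟨l.map φ, by simpa using hl, fun y hy => ?_, by rw [map_list_prod]⟩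
  obtain ⟨x, hx, rfl⟩ := List.mem_map.1 hy
  exact (hT x hx).imp (hφ x) fun h => by simpa using hφ _ h

theorem HasWord.wordLength_le {k : K} {n : ℕ} (h : HasWord T k n) : wordLength T k ≤ n := by
  obtain ⟨l, hl, h'⟩ := h
  refine le_trans ?_ hl
  exact Nat.sInf_le ⟨l, rfl, h'⟩

theorem wordLength_one (T : Set K) : wordLength T 1 = 0 :=
  Nat.le_zero.1 (HasWord.wordLength_le ⟨[], by simp⟩)

theorem hasWord_wordLength (hT : Subgroup.closure T = ⊤) (k : K) :
    HasWord T k (wordLength T k) := by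
  have hk : k ∈ Submonoid.closure (T ∪ T⁻¹) := by
    rw [← Subgroup.closure_toSubmonoid, hT]
    trivial
  obtain ⟨l, hl, rfl⟩ := Submonoid.exists_list_of_mem_closure hk
  obtain ⟨l', hl', h⟩ := Nat.sInf_mem
    (s := {n | ∃ l' : List K, l'.length = n ∧ (∀ x ∈ l', x ∈ T ∨ x⁻¹ ∈ T) ∧ l'.prod = l.prod})
    ⟨_, l, rfl, hl, rfl⟩
  exact ⟨l', hl'.le, h⟩

end Words

section WreathWords

variable {H S : Type*} [Group H]

/-- The embedding of `H` as the lamp at the identity. -/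
noncomputable def lampHom (H S : Type*) [Group H] : H →* StandardWreath H (FreeGroup S) :=
  SemidirectProduct.inl.comp
    { toFun := atOne
      map_one' := by
        ext x
        simp [atOne]
      map_mul' := fun a b => by
        ext x
        by_cases hx : x = 1 <;> simp [atOne, hx] }

theorem lampHom_left_one (h : H) : ((lampHom H S h).left : FreeGroup S → H) 1 = h :=
  if_pos rfl

theorem lampHom_left_of_ne (h : H) {x : FreeGroup S} (hx : x ≠ 1) :
    ((lampHom H S h).left : FreeGroup S → H) x = 1 :=
  if_neg hx

theorem hasWord_lampHom {T : Set H} (hT : Subgroup.closure T = ⊤) (h : H) :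
    HasWord (wreathGen T S) (lampHom H S h) (wordLength T h) :=
  (hasWord_wordLength hT h).map _ fun x hx => Or.inl ⟨x, hx, rfl⟩

theorem hasWord_inr_letter (T : Set H) (t : S × Bool) :
    HasWord (wreathGen T S) (SemidirectProduct.inr (FreeGroup.mk [t])) 1 := by
  refine ⟨[SemidirectProduct.inr (FreeGroup.mk [t])], by simp, ?_, by simp⟩
  obtain ⟨s, b⟩ := t
  simp only [List.mem_singleton, forall_eq]
  cases b
  · right
    rw [← map_inv]
    exact Or.inr ⟨s, rfl⟩
  · exact Or.inl (Or.inr ⟨s, rfl⟩)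

/-- The lamp configuration `w` with the lamp at `f` switched off. -/
noncomputable def switchOff [DecidableEq S] (w : FinSuppSubgroup H (FreeGroup S))
    (f : FreeGroup S) : FinSuppSubgroup H (FreeGroup S) :=
  ⟨Function.update w f 1, w.2.subset fun x hx => by
    by_cases h : x = f <;> simp_all⟩

theorem mk_mul_inr (w : FinSuppSubgroup H (FreeGroup S)) (f g : FreeGroup S) :
    (⟨w, f⟩ : StandardWreath H (FreeGroup S)) * SemidirectProduct.inr g = ⟨w, f * g⟩ := by
  ext <;> simp

theorem switchOff_mul_lampHom [DecidableEq S] (w : FinSuppSubgroup H (FreeGroup S))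
    (f : FreeGroup S) :
    (⟨switchOff w f, f⟩ : StandardWreath H (FreeGroup S)) *
      lampHom H S ((w : FreeGroup S → H) f) = ⟨w, f⟩ := by
  refine SemidirectProduct.ext (Subtype.ext (funext fun x => ?_)) (mul_one f)
  rw [left_mul_apply]
  by_cases h : x = f
  · subst h
    rw [inv_mul_cancel, lampHom_left_one]
    simp [switchOff]
  · rw [lampHom_left_of_ne _ fun h' => h (inv_mul_eq_one.1 h').symm]
    simp [switchOff, h]

variable [DecidableEq S]

theorem sum_switchOff_add (T : Set H) (w : FinSuppSubgroup H (FreeGroup S)) (f : FreeGroup S)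
    {Q : Finset (FreeGroup S)} (hQ : ∀ x ∉ Q, (w : FreeGroup S → H) x = 1) :
    ∑ x ∈ Q.erase f, wordLength T ((switchOff w f : FreeGroup S → H) x) +
      wordLength T ((w : FreeGroup S → H) f) =
    ∑ x ∈ Q, wordLength T ((w : FreeGroup S → H) x) := by
  have h : ∑ x ∈ Q.erase f, wordLength T ((switchOff w f : FreeGroup S → H) x) =
      ∑ x ∈ Q.erase f, wordLength T ((w : FreeGroup S → H) x) :=
    Finset.sum_congr rfl fun x hx => by
      have hxf : x ≠ f := Finset.ne_of_mem_erase hx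
      simp [switchOff, hxf]
  rw [h]
  by_cases hf : f ∈ Q
  · exact Finset.sum_erase_add _ _ hf
  · rw [Finset.erase_eq_of_notMem hf, hQ f hf, wordLength_one, add_zero]

theorem toWord_mul_letter {f : FreeGroup S} {t : S × Bool}
    (h : FreeGroup.IsReduced (f.toWord ++ [t])) :
    (f * FreeGroup.mk [t]).toWord = f.toWord ++ [t] := by
  rw [FreeGroup.toWord_mul, FreeGroup.toWord_mk, FreeGroup.reduce_singleton, h.reduce_eq]

theorem exists_letter_of_prefix {f q : FreeGroup S} (h : f.toWord <+: q.toWord) (hne : q ≠ f) :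
    ∃ t : S × Bool, (f * FreeGroup.mk [t]).toWord = f.toWord ++ [t] ∧
      (f * FreeGroup.mk [t]).toWord <+: q.toWord := by
  obtain ⟨r, hr⟩ := h
  have hr0 : r ≠ [] := by
    rintro rfl
    exact hne (FreeGroup.toWord_injective (by simpa using hr.symm))
  obtain ⟨t, r, rfl⟩ := List.exists_cons_of_ne_nil hr0
  have hp : f.toWord ++ [t] <+: q.toWord := ⟨r, by simpa using hr⟩
  have hw := toWord_mul_letter (FreeGroup.isReduced_toWord.infix hp.isInfix)
  exact ⟨t, hw, hw ▸ hp⟩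

theorem exists_eq_mul_letter {f : FreeGroup S} (hf : f ≠ 1) :
    ∃ (g : FreeGroup S) (t : S × Bool), f = g * FreeGroup.mk [t] ∧
      f.toWord = g.toWord ++ [t] := by
  rcases List.eq_nil_or_concat f.toWord with h | ⟨L, t, h⟩
  · exact absurd (FreeGroup.toWord_eq_nil_iff.1 h) hf
  · rw [List.concat_eq_append] at h
    have hr : FreeGroup.IsReduced f.toWord := FreeGroup.isReduced_toWord
    have hL : (FreeGroup.mk L).toWord = L := by
      rw [h] at hr
      rw [FreeGroup.toWord_mk, (hr.infix (List.prefix_append L [t]).isInfix).reduce_eq]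
    refine ⟨FreeGroup.mk L, t, ?_, by rw [hL, h]⟩
    rw [FreeGroup.mul_mk, ← h, FreeGroup.mk_toWord]

/-- Depth-first exploration of the subtree spanned by `1`, `f` and `Q`, ending at `f`. -/
theorem hasWord_of_two_mul_card_hullEdges_le {T : Set H} (hT : Subgroup.closure T = ⊤) (n : ℕ)
    (Q : Finset (FreeGroup S)) (w : FinSuppSubgroup H (FreeGroup S)) (f : FreeGroup S)
    (hQ : ∀ x ∉ Q, (w : FreeGroup S → H) x = 1)
    (hn : 2 * (hullEdges (insert f Q)).card ≤ n + f.norm) :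
    HasWord (wreathGen T S) ⟨w, f⟩
      (∑ x ∈ Q, wordLength T ((w : FreeGroup S → H) x) + n) := by
  induction n using Nat.strong_induction_on generalizing Q w f with
  | h n ih =>
  by_cases hext : ∃ q ∈ Q, f.toWord <+: q.toWord ∧ q ≠ f
  · obtain ⟨q, hq, hfq, hne⟩ := hext
    obtain ⟨t, ht, htq⟩ := exists_letter_of_prefix hfq hne
    have hsub : hullEdges (insert (f * FreeGroup.mk [t]) Q) ⊆ hullEdges (insert f Q) := by
      intro L hL
      obtain ⟨hL0, x, hx, hLx⟩ := mem_hullEdges.1 hL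
      refine mem_hullEdges.2 ⟨hL0, ?_⟩
      rcases Finset.mem_insert.1 hx with rfl | hx
      · exact ⟨q, Finset.mem_insert_of_mem hq, hLx.trans htq⟩
      · exact ⟨x, Finset.mem_insert_of_mem hx, hLx⟩
    have hcard := Finset.card_le_card hsub
    have hle := norm_le_card_hullEdges (Finset.mem_insert_self (f * FreeGroup.mk [t]) Q)
    have hnorm : (f * FreeGroup.mk [t]).norm = f.norm + 1 := by simp [FreeGroup.norm, ht]
    have hword := (ih (n - 1) (by omega) Q w (f * FreeGroup.mk [t]) hQ (by omega)).mul
      (hasWord_inr_letter T (t.1, !t.2))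
    have hinv : FreeGroup.mk [t] * FreeGroup.mk [(t.1, !t.2)] = 1 := by
      have : FreeGroup.mk [(t.1, !t.2)] = (FreeGroup.mk [t])⁻¹ := rfl
      rw [this, mul_inv_cancel]
    rw [mk_mul_inr, mul_assoc, hinv, mul_one] at hword
    exact hword.mono (by omega)
  · push Not at hext
    rw [← switchOff_mul_lampHom w f, ← sum_switchOff_add T w f hQ]
    suffices h : HasWord (wreathGen T S) ⟨switchOff w f, f⟩
        (∑ x ∈ Q.erase f, wordLength T ((switchOff w f : FreeGroup S → H) x) + n) from
      (h.mul (hasWord_lampHom hT _)).mono (by omega)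
    have hQ' : ∀ x ∉ Q.erase f, (switchOff w f : FreeGroup S → H) x = 1 := by
      intro x hx
      by_cases hxf : x = f
      · simp [switchOff, hxf]
      · have hxQ : x ∉ Q := fun h => hx (Finset.mem_erase.2 ⟨hxf, h⟩)
        simp [switchOff, hxf, hQ x hxQ]
    by_cases hf : f = 1
    · subst hf
      have hw : switchOff w (1 : FreeGroup S) = 1 := by
        refine Subtype.ext (funext fun x => hQ' x fun hx => ?_)
        exact Finset.ne_of_mem_erase hx (hext x (Finset.mem_of_mem_erase hx) (by simp))
      rw [hw]
      exact ⟨[], by simp, by simp, rfl⟩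
    · obtain ⟨g, t, hfg, hfw⟩ := exists_eq_mul_letter hf
      have hnorm : f.norm = g.norm + 1 := by simp [FreeGroup.norm, hfw]
      have hmem : f.toWord ∈ hullEdges (insert f Q) :=
        mem_hullEdges.2 ⟨by simp [hfw], f, Finset.mem_insert_self _ _, List.prefix_rfl⟩
      have hsub : hullEdges (insert g (Q.erase f)) ⊆ (hullEdges (insert f Q)).erase f.toWord := by
        intro L hL
        obtain ⟨hL0, x, hx, hLx⟩ := mem_hullEdges.1 hL
        refine Finset.mem_erase.2 ⟨?_, mem_hullEdges.2 ⟨hL0, ?_⟩⟩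
        · rintro rfl
          rcases Finset.mem_insert.1 hx with rfl | hx
          · have := hLx.length_le
            simp [hfw] at this
          · exact Finset.ne_of_mem_erase hx (hext x (Finset.mem_of_mem_erase hx) hLx)
        · rcases Finset.mem_insert.1 hx with rfl | hx
          · exact ⟨f, Finset.mem_insert_self _ _, hLx.trans ⟨[t], hfw.symm⟩⟩
          · exact ⟨x, Finset.mem_insert_of_mem (Finset.mem_of_mem_erase hx), hLx⟩
      have hcard := Finset.card_le_card hsub
      rw [Finset.card_erase_of_mem hmem] at hcard
      have hle := norm_le_card_hullEdges (Finset.mem_insert_self f Q)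
      have hword := (ih (n - 1) (by omega) (Q.erase f) (switchOff w f) g hQ' (by omega)).mul
        (hasWord_inr_letter T t)
      rw [mk_mul_inr, ← hfg] at hword
      exact hword.mono (by omega)

end WreathWords

open scoped NNReal in
theorem apply_natCast_le {α : ℝ≥0 → ℝ≥0} (h0 : α 0 = 0)
    (hsubadd : ∀ s t : ℝ≥0, α (s + t) ≤ α s + α t) (n : ℕ) : α n ≤ n * α 1 := by
  induction n with
  | zero => simp [h0]
  | succ n ih =>
    rw [Nat.cast_succ, add_one_mul]
    exact (hsubadd _ _).trans (by gcongr)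

end WreathWalls

open scoped NNReal in
/-- **Proposition.** Let `α : ℝ≥0 → ℝ≥0` be nondecreasing and subadditive and let `F = F(S)`
be a finitely generated free group. If a finitely generated group `H` has a left-invariant
measured walls structure whose pseudo-distance admits `α` as a compression function (for the
word length of `S'`), then so does `H ≀ F` (for the word length of `S ∪ S'`). -/
theorem wreath_free_compression_function {H : Type*} [Group H]
    (S' : Finset H) (hgen : Subgroup.closure (S' : Set H) = ⊤)
    (S : Type*) [Finite S]
    (α : ℝ≥0 → ℝ≥0) (hmono : Monotone α) (hsubadd : ∀ s t : ℝ≥0, α (s + t) ≤ α s + α t)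
    (σ : WallMeasure H) (hσ : IsMWS σ) (hσinv : IsLeftInvariantWalls σ)
    (hcomp : ∀ h : H,
      (α (wordLength (S' : Set H) h : ℝ≥0) : ℝ≥0∞) ≤ wallDist σ 1 h) :
    ∃ ρ : WallMeasure (StandardWreath H (FreeGroup S)), IsMWS ρ ∧ IsLeftInvariantWalls ρ ∧
      ∀ γ : StandardWreath H (FreeGroup S),
        (α (wordLength (wreathGen (S' : Set H) S) γ : ℝ≥0) : ℝ≥0∞) ≤ wallDist ρ 1 γ := by
  classical
  have h0 : α 0 = 0 := by
    have h := hcomp 1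
    rw [WreathWalls.wordLength_one, WreathWalls.wallDist_self] at h
    simpa using h
  refine ⟨WreathWalls.lampWalls S σ +
    (2 * α 1 : ℝ≥0∞) • WreathWalls.wallCount (WreathWalls.treeWallSet H S), ?_, ?_, ?_⟩
  · intro y z
    rw [WreathWalls.wallDist_add, WreathWalls.wallDist_smul]
    exact ENNReal.add_lt_top.2 ⟨WreathWalls.isMWS_lampWalls hσ y z,
      ENNReal.mul_lt_top (by finiteness) (WreathWalls.isMWS_treeWalls y z)⟩
  · exact WreathWalls.isLeftInvariantWalls_add (WreathWalls.isLeftInvariantWalls_lampWalls hσinv)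
      (WreathWalls.isLeftInvariantWalls_smul WreathWalls.isLeftInvariantWalls_treeWalls _)
  · intro γ
    rw [WreathWalls.wallDist_add, WreathWalls.wallDist_smul]
    set Q := Set.Finite.toFinset γ.left.2
    set N := (WreathWalls.hullEdges (insert γ.right Q)).card
    have hlen : wordLength (wreathGen (S' : Set H) S) γ ≤
        ∑ x ∈ Q, wordLength (S' : Set H) ((γ.left : FreeGroup S → H) x) + 2 * N :=
      (WreathWalls.hasWord_of_two_mul_card_hullEdges_le hgen (2 * N) Q γ.left γ.right
        (fun x hx => not_not.1 fun h => hx ((Set.Finite.mem_toFinset _).2 h)) (by omega)).wordLength_le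
    have hα : α (wordLength (wreathGen (S' : Set H) S) γ) ≤
        ∑ x ∈ Q, α (wordLength (S' : Set H) ((γ.left : FreeGroup S → H) x)) +
          2 * α 1 * N := by
      calc α (wordLength (wreathGen (S' : Set H) S) γ)
          ≤ α ((∑ x ∈ Q, (wordLength (S' : Set H) ((γ.left : FreeGroup S → H) x) : ℝ≥0)) +
              (2 * N : ℕ)) := hmono (by exact_mod_cast hlen)
        _ ≤ _ := hsubadd _ _
        _ ≤ _ := add_le_add (Finset.le_sum_of_subadditive α h0.le hsubadd Q _)
            (WreathWalls.apply_natCast_le h0 hsubadd _)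
        _ = _ := by push_cast; ring
    calc (α (wordLength (wreathGen (S' : Set H) S) γ) : ℝ≥0∞)
        ≤ ∑ x ∈ Q, (α (wordLength (S' : Set H) ((γ.left : FreeGroup S → H) x)) : ℝ≥0∞) +
            2 * α 1 * N := by exact_mod_cast hα
      _ ≤ _ := add_le_add
          ((Finset.sum_le_sum fun x _ => hcomp _).trans
            (WreathWalls.sum_le_wallDist_lampWalls σ 1 γ Q))
          (mul_le_mul_right (WreathWalls.card_hullEdges_le_wallDist γ) _)
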